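/- arXiv:2405.01001 — 6 statements merged into one kernel-verified Lean document; each statement's English description precedes it below -/
import Mathlib

section
/- For every real number t that is not an integer and every integer j, the family over l ∈ ℤ given by l ↦ (sin(πt))² / (π(j+t-l))² has sum equal to 1 (HasSum with value 1). Equivalently, the ℓ²-coefficient vector (sin(π(j+t-l))/(π(j+t-l)))_{l∈ℤ} of U_t e_j has norm 1. -/
open Real

/-- The `n`-th Fourier coefficient of `x ↦ exp (2πisx)` on `[0, 1]` has squared modulus
`sin² (πs) / (π(s - n))²`. -/
lemma norm_sq_fourierCoeffOn_exp (s : ℝ) (n : ℤ) (hs : s ≠ n) :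
    ‖fourierCoeffOn zero_lt_one (fun x : ℝ => Complex.exp (2 * π * Complex.I * s * x)) n‖ ^ 2 =
      Real.sin (π * s) ^ 2 / (π * (s - n)) ^ 2 := by
  have hsn : s - n ≠ 0 := sub_ne_zero.mpr hs
  have hc : Complex.I * ((2 * π * (s - n) : ℝ) : ℂ) ≠ 0 :=
    mul_ne_zero Complex.I_ne_zero
      (Complex.ofReal_ne_zero.mpr (mul_ne_zero two_pi_pos.ne' hsn))
  have hcoeff : fourierCoeffOn zero_lt_one
      (fun x : ℝ => Complex.exp (2 * π * Complex.I * s * x)) n =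
      (Complex.exp (Complex.I * ((2 * π * (s - n) : ℝ) : ℂ)) - 1) /
        (Complex.I * ((2 * π * (s - n) : ℝ) : ℂ)) := by
    rw [fourierCoeffOn_eq_integral]
    have hint : ∀ x : ℝ, fourier (-n) (x : AddCircle ((1 : ℝ) - 0)) •
        Complex.exp (2 * π * Complex.I * s * x) =
        Complex.exp (Complex.I * ((2 * π * (s - n) : ℝ) : ℂ) * x) := by
      intro x
      rw [fourier_coe_apply, smul_eq_mul, ← Complex.exp_add]
      congr 1
      push_cast
      ring
    simp_rw [hint]
    rw [integral_exp_mul_complex hc]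
    simp
  have hsin : Real.sin (π * (s - n)) ^ 2 = Real.sin (π * s) ^ 2 := by
    rw [mul_sub, mul_comm π (n : ℝ), Real.sin_sub_int_mul_pi, mul_pow, ← sq_abs ((-1 : ℝ) ^ n)]
    simp
  rw [hcoeff, norm_div, Complex.norm_exp_I_mul_ofReal_sub_one, norm_mul Complex.I, Complex.norm_I,
    one_mul, Complex.norm_real, div_pow, Real.norm_eq_abs, Real.norm_eq_abs, sq_abs, sq_abs,
    show 2 * π * (s - n) / 2 = π * (s - n) by ring, mul_pow, hsin,
    show 2 * π * (s - n) = 2 * (π * (s - n)) by ring, mul_pow 2 (π * (s - n)),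
    mul_div_mul_left _ _ (by norm_num)]

lemma hasSum_sin_sq_div (s : ℝ) (hs : ∀ n : ℤ, s ≠ n) :
    HasSum (fun n : ℤ => Real.sin (π * s) ^ 2 / (π * (s - n)) ^ 2) 1 := by
  have hnorm : ∀ x : ℝ, ‖Complex.exp (2 * π * Complex.I * s * x)‖ = 1 := by
    intro x
    rw [show (2 * π * Complex.I * s * x : ℂ) = ((2 * π * s * x : ℝ) : ℂ) * Complex.I by
      push_cast; ring]
    exact Complex.norm_exp_ofReal_mul_I _
  have hL2 : MeasureTheory.MemLp (fun x : ℝ => Complex.exp (2 * π * Complex.I * s * x)) 2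
      (MeasureTheory.volume.restrict (Set.Ioc 0 1)) :=
    MeasureTheory.MemLp.of_bound
      (by fun_prop : Continuous fun x : ℝ =>
        Complex.exp (2 * π * Complex.I * s * x)).aestronglyMeasurable 1
      (Filter.Eventually.of_forall fun x => (hnorm x).le)
  have h := hasSum_sq_fourierCoeffOn zero_lt_one hL2
  simp_rw [norm_sq_fourierCoeffOn_exp s _ (hs _), hnorm] at h
  simpa using h

/-- Normalization of the coefficient vector of `U_t e_j`:
for non-integer `t` and any integer `j`, `Σ_{l∈ℤ} sin²(πt)/(π(j+t-l))² = 1`. -/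
theorem stmt_2 (t : ℝ) (ht : ∀ z : ℤ, t ≠ z) (j : ℤ) :
    HasSum (fun l : ℤ => (Real.sin (Real.pi * t)) ^ 2 / (Real.pi * ((j : ℝ) + t - l)) ^ 2) 1 := by
  have h := (Equiv.subRight j).hasSum_iff.mpr (hasSum_sin_sq_div t ht)
  convert h using 2 with l
  simp only [Function.comp_apply, Equiv.subRight_apply, Int.cast_sub]
  ring_nf
end

section
/- For every real number t that is not an integer and all distinct integers j ≠ j', the family over l ∈ ℤ given by l ↦ (sin(π(j+t-l))/(π(j+t-l))) · (sin(π(j'+t-l))/(π(j'+t-l))) has sum equal to 0 (HasSum with value 0). -/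
open Real

/-- A summable telescoping family over `ℤ` whose primitive vanishes at both ends has sum `0`. -/
lemma hasSum_int_telescope {g : ℤ → ℝ} (hs : Summable fun l => g (l + 1) - g l)
    (htop : Filter.Tendsto g Filter.atTop (nhds 0))
    (hbot : Filter.Tendsto g Filter.atBot (nhds 0)) :
    HasSum (fun l => g (l + 1) - g l) 0 := by
  have hpos : HasSum (fun n : ℕ => g ((n : ℤ) + 1) - g n) (0 - g 0) := by
    have hsum : Summable fun n : ℕ => g ((n : ℤ) + 1) - g n :=
      hs.comp_injective Nat.cast_injective
    rw [hasSum_iff_tendsto_nat_of_summable_norm hsum.norm]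
    have htel (n : ℕ) : ∑ i ∈ Finset.range n, (g ((i : ℤ) + 1) - g i) = g n - g 0 := by
      simpa using Finset.sum_range_sub (fun i : ℕ => g i) n
    simp_rw [htel]
    exact (htop.comp tendsto_natCast_atTop_atTop).sub_const _
  have hneg : HasSum (fun n : ℕ => g (-((n : ℤ) + 1) + 1) - g (-((n : ℤ) + 1))) (g 0 - 0) := by
    have hinj : Function.Injective fun n : ℕ => -((n : ℤ) + 1) := fun a b h => by
      simpa using h
    have hsum : Summable fun n : ℕ => g (-((n : ℤ) + 1) + 1) - g (-((n : ℤ) + 1)) :=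
      hs.comp_injective hinj
    rw [hasSum_iff_tendsto_nat_of_summable_norm hsum.norm]
    have htel (n : ℕ) :
        ∑ i ∈ Finset.range n, (g (-((i : ℤ) + 1) + 1) - g (-((i : ℤ) + 1))) = g 0 - g (-n) := by
      simpa using Finset.sum_range_sub' (fun i : ℕ => g (-i)) n
    simp_rw [htel]
    exact ((hbot.comp (Filter.tendsto_neg_atTop_atBot.comp
      tendsto_natCast_atTop_atTop)).const_sub _)
  simpa using HasSum.of_nat_of_neg_add_one (f := fun l => g (l + 1) - g l) hpos hneg

lemma hasSum_int_sub_comp_add {g : ℤ → ℝ} (h : HasSum (fun l => g (l + 1) - g l) 0) (n : ℤ) :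
    HasSum (fun l => g (l + n) - g l) 0 := by
  have hshift (m : ℤ) : HasSum (fun l => g (l + m + 1) - g (l + m)) 0 :=
    (Equiv.addRight m).hasSum_iff.mpr h
  induction n with
  | zero => simp
  | succ n ih => simpa [add_assoc] using ih.add (hshift n)
  | pred n ih => simpa [add_assoc] using ih.sub (hshift (-n - 1))

lemma summable_inv_add_int_sq (t : ℝ) : Summable fun l : ℤ => ((l + t)⁻¹) ^ 2 := by
  refine ((Real.summable_one_div_int_add_rpow t 2).mpr one_lt_two).congr fun l => ?_
  rw [Real.rpow_two, sq_abs, one_div, inv_pow]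

lemma hasSum_inv_int_add_mul_inv_int_add {t : ℝ} (ht : ∀ z : ℤ, t ≠ z) {n : ℤ} (hn : n ≠ 0) :
    HasSum (fun l : ℤ => ((l : ℝ) + t)⁻¹ * (((l + n : ℤ) : ℝ) + t)⁻¹) 0 := by
  have hne (l : ℤ) : (l : ℝ) + t ≠ 0 := fun h => ht (-l) (by push_cast; linarith)
  have hsub (m l : ℤ) : (((l + m : ℤ) : ℝ) + t)⁻¹ - ((l : ℝ) + t)⁻¹ =
      -m * (((l : ℝ) + t)⁻¹ * (((l + m : ℤ) : ℝ) + t)⁻¹) := by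
    have h₁ := hne l
    have h₂ := hne (l + m)
    field_simp
    push_cast
    ring
  have hsq := summable_inv_add_int_sq t
  have hs : Summable fun l : ℤ => ((l : ℝ) + t)⁻¹ * (((l + 1 : ℤ) : ℝ) + t)⁻¹ := by
    refine (hsq.add ((Equiv.addRight (1 : ℤ)).summable_iff.mpr hsq)).of_norm_bounded fun l => ?_
    simp only [Function.comp_apply, Equiv.coe_addRight, Real.norm_eq_abs]
    rw [abs_le]
    constructor <;>
      nlinarith [sq_nonneg (((l : ℝ) + t)⁻¹ + (((l + 1 : ℤ) : ℝ) + t)⁻¹),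
        sq_nonneg (((l : ℝ) + t)⁻¹ - (((l + 1 : ℤ) : ℝ) + t)⁻¹),
        sq_nonneg ((l : ℝ) + t)⁻¹, sq_nonneg (((l + 1 : ℤ) : ℝ) + t)⁻¹]
  have htel : HasSum (fun l : ℤ => (((l + 1 : ℤ) : ℝ) + t)⁻¹ - ((l : ℝ) + t)⁻¹) 0 := by
    refine hasSum_int_telescope (g := fun l : ℤ => ((l : ℝ) + t)⁻¹) ?_ ?_ ?_
    · exact (hs.mul_left (-((1 : ℤ) : ℝ))).congr fun l => (hsub 1 l).symm
    · exact tendsto_inv_atTop_zero.comp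
        (Filter.tendsto_atTop_add_const_right _ t tendsto_intCast_atTop_atTop)
    · exact tendsto_inv_atBot_zero.comp
        (Filter.tendsto_atBot_add_const_right _ t
          (tendsto_intCast_atBot_iff.mpr Filter.tendsto_id))
  have h := hasSum_int_sub_comp_add (g := fun l : ℤ => ((l : ℝ) + t)⁻¹) htel n
  have hn' : (n : ℝ) ≠ 0 := by exact_mod_cast hn
  simp_rw [hsub n] at h
  simpa [hn'] using h.mul_left (-(n : ℝ))⁻¹

/-- Orthogonality of distinct continuously shifted basis vectors `U_t e_j`, `U_t e_{j'}`:
for non-integer `t` and distinct integers `j ≠ j'`,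
`Σ_{l∈ℤ} sinc(π(j+t-l)) · sinc(π(j'+t-l)) = 0`. -/
theorem stmt_3 (t : ℝ) (ht : ∀ z : ℤ, t ≠ z) (j j' : ℤ) (hjj' : j ≠ j') :
    HasSum (fun l : ℤ =>
      (Real.sin (Real.pi * ((j : ℝ) + t - l)) / (Real.pi * ((j : ℝ) + t - l))) *
        (Real.sin (Real.pi * ((j' : ℝ) + t - l)) / (Real.pi * ((j' : ℝ) + t - l)))) 0 := by
  have h := (Equiv.subLeft j).hasSum_iff.mpr
    (hasSum_inv_int_add_mul_inv_int_add ht (sub_ne_zero.mpr hjj'.symm))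
  have hsin (k l : ℤ) : Real.sin (Real.pi * ((k : ℝ) + t - l)) =
      (-1) ^ k * (-1) ^ l * Real.sin (Real.pi * t) := by
    rw [show Real.pi * ((k : ℝ) + t - l) = Real.pi * t - l * Real.pi + k * Real.pi by ring,
      Real.sin_add_int_mul_pi, Real.sin_sub_int_mul_pi, mul_assoc]
  have hone (l : ℤ) : ((-1 : ℝ) ^ l) * (-1) ^ l = 1 := by
    rw [← mul_zpow]
    simp
  rw [← mul_zero ((-1) ^ j * (-1) ^ j' * (Real.sin (Real.pi * t) / Real.pi) ^ 2)]
  refine (h.mul_left _).congr_fun fun l => ?_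
  simp only [Function.comp_apply, Equiv.subLeft_apply]
  rw [hsin, hsin, div_eq_mul_inv, div_eq_mul_inv, mul_inv, mul_inv,
    show ((j - l : ℤ) : ℝ) + t = j + t - l by push_cast; ring,
    show ((j - l + (j' - j) : ℤ) : ℝ) + t = j' + t - l by push_cast; ring]
  linear_combination ((-1) ^ j * (-1) ^ j' * (Real.sin (Real.pi * t) / Real.pi) ^ 2 *
    (((j : ℝ) + t - l)⁻¹ * ((j' : ℝ) + t - l)⁻¹)) * hone l
end

section
/- Let s, t be real numbers such that t, s, and s + t are all non-integers, and let j, m be integers. Then the family over l ∈ ℤ given by l ↦ (sin(π(j+t-l))/(π(j+t-l))) · (sin(π(l+s-m))/(π(l+s-m))) has sum equal to sin(π(j+t+s-m))/(π(j+t+s-m)) (HasSum with that value). -/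
open Real

theorem summable_inv_add_sub_inv {x : ℂ} (hx : x ∈ Complex.integerComplement) :
    Summable (fun l : ℤ => (x + l)⁻¹ - (l : ℂ)⁻¹) := by
  have hprod : Summable (fun l : ℤ => ((x + l) * (l : ℂ))⁻¹) := by
    apply EisensteinSeries.summable_inv_of_isBigO_rpow_inv (a := 2) (by norm_num)
    simpa [pow_two] using (EisensteinSeries.linear_inv_isBigO_right 0 x).mul
      (EisensteinSeries.linear_inv_isBigO_right 1 x)
  refine (Finset.summable_compl_iff {0}).mp
    (((Finset.summable_compl_iff {0}).mpr (hprod.mul_left (-x))).congr fun l => ?_)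
  have hl : ((l : ℤ) : ℂ) ≠ 0 := by simpa using l.2
  have hxl := Complex.integerComplement_add_ne_zero hx l
  field_simp
  ring

theorem hasSum_inv_add_sub_inv {x : ℂ} (hx : x ∈ Complex.integerComplement) :
    HasSum (fun l : ℤ => (x + l)⁻¹ - (l : ℂ)⁻¹) (π * Complex.cot (π * x)) := by
  have hsum := summable_inv_add_sub_inv hx
  have hsymm := (hasSum_nat_add_iff' 1).mpr hsum.hasSum.nat_add_neg
  have hcot := (summable_cotTerm hx).hasSum
  have hfun : (fun n : ℕ => cotTerm x n) = fun n : ℕ =>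
      ((x + ((n + 1 : ℕ) : ℤ))⁻¹ - (((n + 1 : ℕ) : ℤ) : ℂ)⁻¹) +
        ((x + ((-((n + 1 : ℕ) : ℤ) : ℤ) : ℂ))⁻¹ - ((-((n + 1 : ℕ) : ℤ) : ℤ) : ℂ)⁻¹) := by
    funext n
    simp only [cotTerm]
    push_cast
    rw [inv_neg]
    ring
  have hval := cot_series_rep' hx
  change _ = ∑' n, cotTerm x n at hval
  rw [← hval, hfun] at hcot
  have heq := hcot.unique hsymm
  have hcotsum : π * Complex.cot (π * x) = ∑' l : ℤ, ((x + l)⁻¹ - (l : ℂ)⁻¹) := by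
    simpa using heq
  exact hcotsum ▸ hsum.hasSum

theorem hasSum_real_inv_add_sub_inv {x : ℝ} (hx : ∀ z : ℤ, x ≠ z) :
    HasSum (fun l : ℤ => (x + l)⁻¹ - (l : ℝ)⁻¹) (π * Real.cot (π * x)) := by
  have hx' : (x : ℂ) ∈ Complex.integerComplement := by
    rintro ⟨z, hz⟩
    exact hx z (by exact_mod_cast hz.symm)
  have := hasSum_inv_add_sub_inv hx'
  rw [← Complex.hasSum_ofReal]
  push_cast
  exact this

theorem hasSum_inv_sub_mul_inv_add {a b : ℝ} (ha : ∀ z : ℤ, a ≠ z) (hb : ∀ z : ℤ, b ≠ z)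
    (hab : a + b ≠ 0) :
    HasSum (fun l : ℤ => (a - l)⁻¹ * (l + b)⁻¹)
      ((a + b)⁻¹ * (π * cot (π * a) + π * cot (π * b))) := by
  have hA := (Equiv.neg ℤ).hasSum_iff.mpr (hasSum_real_inv_add_sub_inv ha)
  refine ((hA.add (hasSum_real_inv_add_sub_inv hb)).mul_left (a + b)⁻¹).congr_fun fun l => ?_
  have h1 : a - l ≠ 0 := sub_ne_zero.mpr (ha l)
  have h2 : l + b ≠ 0 := fun h => hb (-l) (by push_cast; linarith)
  have h : (a + b)⁻¹ * ((a - l)⁻¹ + (l + b)⁻¹) = (a - l)⁻¹ * (l + b)⁻¹ := by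
    field_simp
    ring
  simp only [Function.comp_apply, Equiv.neg_apply, Int.cast_neg, inv_neg, ← sub_eq_add_neg,
    add_comm b, ← h]
  ring

/-- The group law `U_{s+t} = U_s ∘ U_t` in matrix coefficients: for `t, s, s+t ∉ ℤ`
and integers `j, m`,
`Σ_{l∈ℤ} sinc(π(j+t-l)) · sinc(π(l+s-m)) = sinc(π(j+t+s-m))`. -/
theorem stmt_4 (s t : ℝ) (ht : ∀ z : ℤ, t ≠ z) (hs : ∀ z : ℤ, s ≠ z)
    (hst : ∀ z : ℤ, s + t ≠ z) (j m : ℤ) :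
    HasSum (fun l : ℤ =>
      (Real.sin (Real.pi * ((j : ℝ) + t - l)) / (Real.pi * ((j : ℝ) + t - l))) *
        (Real.sin (Real.pi * ((l : ℝ) + s - m)) / (Real.pi * ((l : ℝ) + s - m))))
      (Real.sin (Real.pi * ((j : ℝ) + t + s - m)) / (Real.pi * ((j : ℝ) + t + s - m))) := by
  have ha : ∀ z : ℤ, (j : ℝ) + t ≠ z := fun z h => ht (z - j) (by push_cast; linarith)
  have hb : ∀ z : ℤ, s - m ≠ z := fun z h => hs (z + m) (by push_cast; linarith)
  have hab : (j + t) + (s - m) ≠ 0 := fun h => hst (m - j) (by push_cast; linarith)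
  have hsin {x : ℝ} (hx : ∀ z : ℤ, x ≠ z) : sin (π * x) ≠ 0 := by
    rw [Real.sin_ne_zero_iff]
    intro n hn
    exact hx n (mul_left_cancel₀ pi_ne_zero (by linarith))
  have hterm (l : ℤ) : sin (π * (j + t - l)) / (π * (j + t - l)) *
      (sin (π * (l + s - m)) / (π * (l + s - m))) =
      sin (π * (j + t)) * sin (π * (s - m)) / π ^ 2 * ((j + t - l)⁻¹ * (l + (s - m))⁻¹) := by
    have hsign : ((-1 : ℝ) ^ l) * (-1) ^ l = 1 := by rw [← mul_zpow]; simp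
    have hnum : sin (π * (j + t - l)) * sin (π * (l + s - m)) =
        sin (π * (j + t)) * sin (π * (s - m)) := by
      rw [show π * (j + t - l) = π * (j + t) - l * π by ring,
        show π * (l + s - m) = π * (s - m) + l * π by ring, sin_sub_int_mul_pi,
        sin_add_int_mul_pi]
      linear_combination sin (π * (j + t)) * sin (π * (s - m)) * hsign
    rw [div_mul_div_comm, hnum, add_sub_assoc (l : ℝ)]
    simp only [div_eq_mul_inv, mul_inv]
    ring
  have hvalue : sin (π * (j + t + s - m)) / (π * (j + t + s - m)) =
      sin (π * (j + t)) * sin (π * (s - m)) / π ^ 2 * (((j + t) + (s - m))⁻¹ *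
        (π * cot (π * (j + t)) + π * cot (π * (s - m)))) := by
    have h1 := hsin ha
    have h2 := hsin hb
    rw [show (j : ℝ) + t + s - m = (j + t) + (s - m) by ring, mul_add π, sin_add, ← mul_add π,
      cot_eq_cos_div_sin, cot_eq_cos_div_sin]
    field_simp
    ring
  simp_rw [hterm, hvalue]
  exact (hasSum_inv_sub_mul_inv_add ha hb hab).mul_left _
end

section
/- For every real number t that is not an integer, the family over pairs (m, n) ∈ ℕ × ℕ given by (m, n) ↦ ‖(1/(2π)) ∫_{-π}^{π} e^{-i((m+1)+t+(n+1))k} dk‖² is NOT summable. -/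
open Real Complex intervalIntegral

/-- The normalized Fourier integral of a character of non-zero real frequency is a `sinc` value. -/
theorem fourier_integral_eq_sin_div {x : ℝ} (hx : x ≠ 0) :
    (1 / (2 * (Real.pi : ℂ))) *
        ∫ k in (-Real.pi)..Real.pi, Complex.exp (-Complex.I * (x : ℂ) * (k : ℂ)) =
      ((Real.sin (x * Real.pi) / (Real.pi * x) : ℝ) : ℂ) := by
  have hxC : (x : ℂ) ≠ 0 := by exact_mod_cast hx
  have hpi : (Real.pi : ℂ) ≠ 0 := by exact_mod_cast Real.pi_ne_zero
  have hI : -Complex.I * (x : ℂ) ≠ 0 := mul_ne_zero (neg_ne_zero.2 Complex.I_ne_zero) hxC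
  rw [integral_exp_mul_complex hI]
  push_cast
  rw [Complex.sin,
    show -Complex.I * (x : ℂ) * (Real.pi : ℂ) = -((x : ℂ) * Real.pi) * Complex.I by ring,
    show -Complex.I * (x : ℂ) * -(Real.pi : ℂ) = (x : ℂ) * Real.pi * Complex.I by ring]
  field_simp
  rw [Complex.I_sq]
  ring

/-- The square of `sin (t * π)` is invariant under translations of `t` by natural numbers. -/
theorem sin_add_nat_mul_pi_sq (t : ℝ) (N : ℕ) :
    Real.sin ((t + N) * Real.pi) ^ 2 = Real.sin (t * Real.pi) ^ 2 := by
  rw [add_mul, Real.sin_add_nat_mul_pi, mul_pow, ← pow_mul, mul_comm N 2, pow_mul]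
  simp

theorem sin_mul_pi_ne_zero {t : ℝ} (ht : ∀ z : ℤ, t ≠ z) : Real.sin (t * Real.pi) ≠ 0 := by
  intro h
  obtain ⟨z, hz⟩ := Real.sin_eq_zero_iff.1 h
  exact ht z (mul_right_cancel₀ Real.pi_ne_zero hz).symm

/-- The double series `∑ 1 / (m + n + 1) ^ 2` diverges. -/
theorem not_summable_inv_add_add_one_sq :
    ¬ Summable (fun p : ℕ × ℕ => (((p.1 + p.2 : ℕ) : ℝ) + 1)⁻¹ ^ 2) := by
  intro h
  have hs := ((Finset.HasAntidiagonal.sigmaAntidiagonalEquivProd (A := ℕ)).summable_iff.2 h).sigma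
  refine not_summable_natCast_inv ((summable_nat_add_iff 1).1 (hs.congr fun n => ?_))
  have hn : (n : ℝ) + 1 ≠ 0 := by positivity
  have hterm : ∀ c : Finset.HasAntidiagonal.antidiagonal n,
      ((fun p : ℕ × ℕ => (((p.1 + p.2 : ℕ) : ℝ) + 1)⁻¹ ^ 2) ∘
        Finset.HasAntidiagonal.sigmaAntidiagonalEquivProd) ⟨n, c⟩ = ((n : ℝ) + 1)⁻¹ ^ 2 := by
    rintro ⟨⟨a, b⟩, hab⟩
    simp [Finset.HasAntidiagonal.sigmaAntidiagonalEquivProd, ← Finset.HasAntidiagonal.mem_antidiagonal.1 hab]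
  rw [tsum_congr hterm, tsum_fintype]
  simp
  field_simp

/-- Divergence of the sum of squared matrix elements
`Σ_{m,n≥1} |⟨e_{-m}, U_t e_n⟩|² = Σ_{m,n≥1} |(1/(2π)) ∫_{-π}^{π} e^{-i(m+t+n)k} dk|²`
for non-integer `t`. Positive integers are encoded as `m+1, n+1` with `m, n : ℕ`. -/
theorem stmt_6 (t : ℝ) (ht : ∀ z : ℤ, t ≠ z) :
    ¬ Summable (fun p : ℕ × ℕ =>
      ‖(1 / (2 * (Real.pi : ℂ))) *
        ∫ k in (-Real.pi)..Real.pi,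
          Complex.exp (-Complex.I * (((((p.1 : ℝ) + 1) + t + ((p.2 : ℝ) + 1)) : ℝ) : ℂ) *
            (k : ℂ))‖ ^ 2) := by
  intro h
  have hs := sin_mul_pi_ne_zero ht
  refine not_summable_inv_add_add_one_sq
    (Summable.of_nonneg_of_le (fun p => by positivity) (fun p => ?_)
      (h.mul_left ((Real.pi * (2 + |t|)) ^ 2 / Real.sin (t * Real.pi) ^ 2)))
  obtain ⟨m, n⟩ := p
  have hxt : (m : ℝ) + 1 + t + ((n : ℝ) + 1) = t + ((m + n + 2 : ℕ) : ℝ) := by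
    push_cast; ring
  have hx : t + ((m + n + 2 : ℕ) : ℝ) ≠ 0 := fun h0 =>
    ht (-((m + n + 2 : ℕ) : ℤ)) (by push_cast at h0 ⊢; linarith)
  have hbound : |t + ((m + n + 2 : ℕ) : ℝ)| ≤ (2 + |t|) * (((m + n : ℕ) : ℝ) + 1) := by
    have hN : (0 : ℝ) ≤ ((m + n : ℕ) : ℝ) := Nat.cast_nonneg _
    have h1 := abs_add_le t ((m + n + 2 : ℕ) : ℝ)
    rw [Nat.abs_cast] at h1
    push_cast at h1 hN ⊢
    nlinarith [mul_nonneg (abs_nonneg t) hN]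
  dsimp only
  rw [hxt, fourier_integral_eq_sin_div hx, Complex.norm_real, Real.norm_eq_abs, sq_abs,
    div_pow, sin_add_nat_mul_pi_sq]
  have hsq := pow_le_pow_left₀ (abs_nonneg _) hbound 2
  rw [sq_abs] at hsq
  have hpi := Real.pi_ne_zero
  generalize t + ((m + n + 2 : ℕ) : ℝ) = x at *
  generalize Real.sin (t * Real.pi) = s at *
  have hN : (0 : ℝ) < ((m + n : ℕ) : ℝ) + 1 := by positivity
  have hx2 : 0 < x ^ 2 := by positivity
  calc (((m + n : ℕ) : ℝ) + 1)⁻¹ ^ 2 ≤ (2 + |t|) ^ 2 / x ^ 2 := by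
        rw [inv_pow, inv_eq_one_div, div_le_div_iff₀ (by positivity) hx2, one_mul, ← mul_pow]
        exact hsq
    _ = _ := by field_simp
end

section
/- For every real number t that is not an integer and every integer j, the set { l ∈ ℤ : (1/(2π)) ∫_{-π}^{π} e^{i(j+t)k} e^{-ilk} dk ≠ 0 } is all of ℤ (in particular it is infinite, so the coefficient family of U_t e_j over the standard basis is not finitely supported). -/
open Real Complex intervalIntegral

/-- The integral of `e^{iak}` over `[-π, π]` does not vanish when `a` is not an integer. -/
theorem integral_exp_I_mul_ne_zero {a : ℝ} (ha : ∀ n : ℤ, a ≠ n) :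
    ∫ k in (-Real.pi)..Real.pi, Complex.exp (Complex.I * (a : ℂ) * (k : ℂ)) ≠ 0 := by
  have ha0 : (a : ℂ) ≠ 0 := by simpa using ha 0
  have hc : Complex.I * (a : ℂ) ≠ 0 := mul_ne_zero Complex.I_ne_zero ha0
  rw [integral_exp_mul_complex hc]
  refine div_ne_zero (sub_ne_zero.mpr fun h => ?_) hc
  obtain ⟨n, hn⟩ := Complex.exp_eq_exp_iff_exists_int.mp h
  refine ha n ?_
  have hpi : (2 * Real.pi * Complex.I : ℂ) ≠ 0 := Complex.two_pi_I_ne_zero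
  have key : (a : ℂ) = n := by
    refine mul_right_cancel₀ hpi ?_
    push_cast at hn
    linear_combination hn
  exact_mod_cast key

/-- Violation of locality: for non-integer `t` and any integer `j`, every coefficient
`(1/(2π)) ∫_{-π}^{π} e^{i(j+t)k} e^{-ilk} dk` of `U_t e_j` is nonzero, i.e. the set of
`l` with nonzero coefficient is all of `ℤ`. -/
theorem stmt_10 (t : ℝ) (ht : ∀ z : ℤ, t ≠ z) (j : ℤ) :
    { l : ℤ |
      (1 / (2 * (Real.pi : ℂ))) *
        ∫ k in (-Real.pi)..Real.pi,
          Complex.exp (Complex.I * (((j : ℝ) + t : ℝ) : ℂ) * (k : ℂ)) *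
            Complex.exp (-Complex.I * ((l : ℝ) : ℂ) * (k : ℂ)) ≠ 0 } = Set.univ := by
  refine Set.eq_univ_of_forall fun l => ?_
  have hpi : (1 / (2 * (Real.pi : ℂ))) ≠ 0 := by simp [Real.pi_ne_zero]
  refine mul_ne_zero hpi ?_
  have ha : ∀ n : ℤ, (j : ℝ) + t - l ≠ n := fun n h => ht (n + l - j) (by
    push_cast
    linarith)
  convert integral_exp_I_mul_ne_zero ha using 4 with k
  rw [← Complex.exp_add]
  congr 1
  push_cast
  ring
end

section
/- Let A be a complex C*-algebra. Let α : ℝ → (A ≃⋆ₐ[ℂ] A) be a one-parameter group of *-automorphisms, i.e., α(0) = id, α(s+t) = α(s) ∘ α(t) for all s, t ∈ ℝ, and for every a ∈ A the map t ↦ α(t)(a) is continuous in norm. Suppose given star-subalgebras F(a, b) ⊆ A for each pair of integers a ≤ b such that: (i) F is monotone, i.e., a' ≤ a and b ≤ b' imply F(a,b) ⊆ F(a',b'); (ii) if b < c then every element of F(a,b) commutes with every element of F(c,d) (for all a ≤ b < c ≤ d); (iii) the union of the F(-N, N) over N ∈ ℕ is dense in A; (iv) α(1) maps F(a,b) onto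 F(a+1, b+1) for all a ≤ b. Then for all x, y ∈ A, the norm ‖x · α(t)(y) − α(t)(y) · x‖ tends to 0 as |t| → ∞ (i.e., along the cocompact filter on ℝ). -/
open Filter Topology

theorem norm_commutator_le_add {A : Type*} [NormedRing A] (x x' w w' : A) :
    ‖x * w - w * x‖ ≤ ‖x' * w' - w' * x'‖ + 2 * ‖x - x'‖ * ‖w‖ + 2 * ‖x'‖ * ‖w - w'‖ := by
  have h : x * w - w * x = (x' * w' - w' * x') + ((x - x') * w - w * (x - x'))
      + (x' * (w - w') - (w - w') * x') := by noncomm_ring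
  have commutator_le (u v : A) : ‖u * v - v * u‖ ≤ 2 * ‖u‖ * ‖v‖ := by
    linarith [norm_sub_le (u * v) (v * u), norm_mul_le u v, norm_mul_le v u,
      mul_comm ‖u‖ ‖v‖]
  rw [h]
  linarith [norm_add₃_le (a := x' * w' - w' * x') (b := (x - x') * w - w * (x - x'))
    (c := x' * (w - w') - (w - w') * x'), commutator_le (x - x') w, commutator_le x' (w - w')]

theorem Dense.exists_mul_norm_sub_lt {A : Type*} [NormedRing A] {S : Set A} (hS : Dense S)
    (x : A) {C ε : ℝ} (hC : 0 ≤ C) (hε : 0 < ε) : ∃ x' ∈ S, C * ‖x - x'‖ < ε := by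
  obtain ⟨x', hx', h⟩ := hS.exists_dist_lt x (ε := ε / (C + 1)) (by positivity)
  refine ⟨x', hx', ?_⟩
  rw [dist_eq_norm, lt_div_iff₀ (by positivity)] at h
  nlinarith [norm_nonneg (x - x')]

theorem StarAlgEquiv.norm_apply_eq {A : Type*} [NormedRing A] [StarRing A] [CStarRing A]
    [NormedAlgebra ℂ A] [StarModule ℂ A] [CompleteSpace A] (f : A ≃⋆ₐ[ℂ] A) (a : A) :
    ‖f a‖ = ‖a‖ := by
  let _ : CStarAlgebra A := {}
  exact StarAlgEquiv.norm_map f a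

theorem mem_local_of_int_shift {A : Type*} [NormedRing A] [StarRing A]
    [NormedAlgebra ℂ A] [StarModule ℂ A]
    {α : ℝ → (A ≃⋆ₐ[ℂ] A)}
    (hα0 : ∀ a : A, α 0 a = a)
    (hαadd : ∀ s t : ℝ, ∀ a : A, α (s + t) a = α s (α t a))
    {F : ℤ → ℤ → StarSubalgebra ℂ A}
    (hshift : ∀ a b : ℤ, a ≤ b →
      (fun x : A => α 1 x) '' (F a b : Set A) = (F (a + 1) (b + 1) : Set A))
    {a b : ℤ} (hab : a ≤ b) {z : A} (hz : z ∈ F a b) (n : ℤ) :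
    α n z ∈ F (a + n) (b + n) := by
  induction n using Int.induction_on with
  | zero => simpa [hα0] using hz
  | succ n ih =>
    have h : α 1 (α (n : ℤ) z) ∈ (F (a + n + 1) (b + n + 1) : Set A) :=
      hshift (a + n) (b + n) (by lia) ▸ ⟨_, ih, rfl⟩
    rw [← hαadd, add_comm 1, add_assoc a, add_assoc b] at h
    exact_mod_cast h
  | pred n ih =>
    have h : α (-n : ℤ) z ∈ (F (a + (-n - 1) + 1) (b + (-n - 1) + 1) : Set A) := by
      rw [show a + (-n - 1) + 1 = a + -n by ring, show b + (-n - 1) + 1 = b + -n by ring]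
      exact ih
    rw [← hshift _ _ (by lia)] at h
    obtain ⟨u, hu, huz⟩ := h
    have : α ((-n - 1 : ℤ) : ℝ) z = u := by
      have e : ((-n - 1 : ℤ) : ℝ) = -1 + ((-n : ℤ) : ℝ) := by push_cast; ring
      rw [e, hαadd, ← huz, ← hαadd, neg_add_cancel, hα0]
    rwa [this]

theorem eventually_norm_commutator_int_lt {A : Type*} [NormedRing A] [StarRing A] [CStarRing A]
    [NormedAlgebra ℂ A] [StarModule ℂ A] [CompleteSpace A]
    {α : ℝ → (A ≃⋆ₐ[ℂ] A)}
    (hα0 : ∀ a : A, α 0 a = a)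
    (hαadd : ∀ s t : ℝ, ∀ a : A, α (s + t) a = α s (α t a))
    {F : ℤ → ℤ → StarSubalgebra ℂ A}
    (hcomm : ∀ a b c d : ℤ, a ≤ b → b < c → c ≤ d →
      ∀ x ∈ F a b, ∀ y ∈ F c d, x * y = y * x)
    (hdense : Dense (⋃ N : ℕ, (F (-(N : ℤ)) (N : ℤ) : Set A)))
    (hshift : ∀ a b : ℤ, a ≤ b →
      (fun x : A => α 1 x) '' (F a b : Set A) = (F (a + 1) (b + 1) : Set A))
    (x z : A) {ε : ℝ} (hε : 0 < ε) :
    ∀ᶠ n : ℤ in cofinite, ‖x * α n z - α n z * x‖ < ε := by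
  obtain ⟨x', hx', hxx'⟩ := hdense.exists_mul_norm_sub_lt x (C := 2 * ‖z‖) (by positivity)
    (half_pos hε)
  obtain ⟨z', hz', hzz'⟩ := hdense.exists_mul_norm_sub_lt z (C := 2 * ‖x'‖) (by positivity)
    (half_pos hε)
  obtain ⟨N, hN⟩ := Set.mem_iUnion.1 hx'
  obtain ⟨M, hM⟩ := Set.mem_iUnion.1 hz'
  have hzero (n : ℤ) (hn : n < -(N + M : ℤ) ∨ (N + M : ℤ) < n) :
      x' * α n z' = α n z' * x' := by
    have hmem := mem_local_of_int_shift hα0 hαadd hshift (by lia) hM n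
    rcases hn with hn | hn
    · exact (hcomm _ _ _ _ (by lia) (by lia) (by lia) _ hmem _ hN).symm
    · exact hcomm _ _ _ _ (by lia) (by lia) (by lia) _ hN _ hmem
  have hfar : ∀ᶠ n : ℤ in cofinite, n < -(N + M : ℤ) ∨ (N + M : ℤ) < n := by
    rw [Int.cofinite_eq, eventually_sup]
    exact ⟨(eventually_lt_atBot _).mono fun _ => Or.inl,
      (eventually_gt_atTop _).mono fun _ => Or.inr⟩
  filter_upwards [hfar] with n hn
  have h := norm_commutator_le_add x x' (α n z) (α n z')
  rw [hzero n hn, sub_self, norm_zero, ← map_sub, StarAlgEquiv.norm_apply_eq,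
    StarAlgEquiv.norm_apply_eq] at h
  linarith [mul_right_comm 2 ‖z‖ ‖x - x'‖]



/-- Asymptotic abelianness: let `A` be a C*-algebra, `α : ℝ → (A ≃⋆ₐ[ℂ] A)` a
one-parameter group of *-automorphisms with `t ↦ α t a` norm continuous, and
`F a b` (for integers `a ≤ b`) local star-subalgebras satisfying monotonicity,
commutativity for disjoint intervals, density of the union of the `F (-N) N`,
and the shift property `α 1 '' F a b = F (a+1) (b+1)`. Then
`‖x · α_t(y) − α_t(y) · x‖ → 0` as `|t| → ∞`, for all `x, y ∈ A`. -/
theorem stmt_12 (A : Type*) [NormedRing A] [StarRing A] [CStarRing A]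
    [NormedAlgebra ℂ A] [StarModule ℂ A] [CompleteSpace A]
    (α : ℝ → (A ≃⋆ₐ[ℂ] A))
    (hα0 : ∀ a : A, α 0 a = a)
    (hαadd : ∀ s t : ℝ, ∀ a : A, α (s + t) a = α s (α t a))
    (hαcont : ∀ a : A, Continuous fun t : ℝ => α t a)
    (F : ℤ → ℤ → StarSubalgebra ℂ A)
    (hmono : ∀ a' a b b' : ℤ, a' ≤ a → b ≤ b' → F a b ≤ F a' b')
    (hcomm : ∀ a b c d : ℤ, a ≤ b → b < c → c ≤ d →
      ∀ x ∈ F a b, ∀ y ∈ F c d, x * y = y * x)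
    (hdense : Dense (⋃ N : ℕ, (F (-(N : ℤ)) (N : ℤ) : Set A)))
    (hshift : ∀ a b : ℤ, a ≤ b →
      (fun x : A => α 1 x) '' (F a b : Set A) = (F (a + 1) (b + 1) : Set A)) :
    ∀ x y : A,
      Filter.Tendsto (fun t : ℝ => ‖x * α t y - α t y * x‖) (Filter.cocompact ℝ) (𝓝 0) := by
  intro x y
  refine tendsto_order.2
    ⟨fun r hr => .of_forall fun t => hr.trans_le (norm_nonneg _), fun ε hε => ?_⟩
  have hunif : ∀ᶠ n : ℤ in cofinite, ∀ s ∈ Set.Icc (0 : ℝ) 1,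
      ‖x * α n (α s y) - α n (α s y) * x‖ < ε := by
    refine isCompact_Icc.induction_on
      (p := fun U : Set ℝ => ∀ᶠ n : ℤ in cofinite, ∀ s ∈ U,
        ‖x * α n (α s y) - α n (α s y) * x‖ < ε) (by simp) ?_ ?_ ?_
    · exact fun U V hUV hV => hV.mono fun n hn s hs => hn s (hUV hs)
    · intro U V hU hV
      filter_upwards [hU, hV] with n h₁ h₂ s hs
      exact hs.elim (h₁ s) (h₂ s)
    · intro s _
      have hcont : Continuous fun r : ℝ => 2 * ‖x‖ * ‖α r y - α s y‖ :=
        continuous_const.mul ((hαcont y).sub continuous_const).norm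
      have hnear : ∀ᶠ r in 𝓝 s, 2 * ‖x‖ * ‖α r y - α s y‖ < ε / 2 :=
        hcont.continuousAt.eventually_lt continuousAt_const (by simpa using half_pos hε)
      refine ⟨_, mem_nhdsWithin_of_mem_nhds hnear, ?_⟩
      filter_upwards [eventually_norm_commutator_int_lt hα0 hαadd hcomm hdense hshift x (α s y)
        (half_pos hε)] with n hn r hr
      have h := norm_commutator_le_add x x (α n (α r y)) (α n (α s y))
      rw [← map_sub, StarAlgEquiv.norm_apply_eq (α n) (α r y - α s y), sub_self, norm_zero] at h
      have hr' : 2 * ‖x‖ * ‖α r y - α s y‖ < ε / 2 := hr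
      linarith
  have hfloor : Tendsto (fun t : ℝ => ⌊t⌋) (cocompact ℝ) cofinite := by
    rw [cocompact_eq_atBot_atTop, Int.cofinite_eq]
    exact tendsto_floor_atBot.sup_sup tendsto_floor_atTop
  filter_upwards [hfloor.eventually hunif] with t ht
  have h := ht (Int.fract t) ⟨Int.fract_nonneg t, (Int.fract_lt_one t).le⟩
  rwa [← hαadd, Int.floor_add_fract] at h
end
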